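/- Let q be a positive integer, and let m be the size of a maximum matching in a bipartite graph H with partite sets A and B. If |B| > m·q and there are no isolated vertices in B, then there exist nonempty vertex sets S ⊆ A and T ⊆ B such that S is saturated by q-stars into T and S = N_H(T). -/

import Mathlib

/-- A matching in a graph `H`: a set of edges whose endpoints are all distinct. -/
def IsMatchingSet {V : Type*} (H : SimpleGraph V) (M : Set (Sym2 V)) : Prop :=
  (∀ e ∈ M, e ∈ H.edgeSet) ∧
    ∀ e ∈ M, ∀ e' ∈ M, e ≠ e' → ∀ v : V, v ∈ e → v ∉ e'

/-- `S` is saturated by `q`-stars into `T` in `H`: one can assign to every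
`v ∈ S` a set `f v ⊆ N_H(v) ∩ T` of size `q` such that the assigned sets are
pairwise disjoint. -/
def SaturatedByStars {V : Type*} (H : SimpleGraph V) (q : ℕ) (S T : Set V) : Prop :=
  ∃ f : V → Set V, (∀ v ∈ S, f v ⊆ H.neighborSet v ∩ T ∧ (f v).ncard = q) ∧
    ∀ u ∈ S, ∀ v ∈ S, u ≠ v → Disjoint (f u) (f v)

open scoped Classical in
/-- The vertices of `B` all of whose neighbours lie in `U`. -/
noncomputable def enclosedBy {V : Type*} [Fintype V] (H : SimpleGraph V) (B : Set V)
    (U : Finset V) : Finset V :=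
  {b | b ∈ B ∧ ∀ u, H.Adj b u → u ∈ U}

theorem mem_enclosedBy {V : Type*} [Fintype V] {H : SimpleGraph V} {B : Set V}
    {U : Finset V} {b : V} : b ∈ enclosedBy H B U ↔ b ∈ B ∧ ∀ u, H.Adj b u → u ∈ U := by
  simp [enclosedBy]

/-- A choice of neighbour for every vertex of a set `X ⊆ B`, injective and with values outside
`B`, gives a matching with `X.card` edges. -/
theorem exists_isMatchingSet_of_injOn {V : Type*} (H : SimpleGraph V) (B : Set V)
    (X : Finset V) (hX : ∀ x ∈ X, x ∈ B) (g : V → V) (hg : Set.InjOn g X)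
    (hadj : ∀ x ∈ X, H.Adj x (g x)) (hgB : ∀ x ∈ X, g x ∉ B) :
    ∃ M : Set (Sym2 V), IsMatchingSet H M ∧ M.ncard = X.card := by
  have key : ∀ x ∈ X, ∀ y ∈ X, ∀ v, v ∈ s(x, g x) → v ∈ s(y, g y) → x = y := by
    intro x hx y hy v hvx hvy
    rw [Sym2.mem_iff] at hvx hvy
    rcases hvx with rfl | rfl <;> rcases hvy with h | h
    · exact h
    · exact absurd (h ▸ hX _ hx) (hgB y hy)
    · exact absurd (h ▸ hX _ hy) (hgB x hx)
    · exact hg hx hy h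
  refine ⟨(fun x => s(x, g x)) '' X, ⟨?_, ?_⟩, ?_⟩
  · rintro _ ⟨x, hx, rfl⟩
    exact hadj x hx
  · rintro _ ⟨x, hx, rfl⟩ _ ⟨y, hy, rfl⟩ hne v hvx hvy
    exact hne (by rw [key x hx y hy v hvx hvy])
  · rw [Set.InjOn.ncard_image, Set.ncard_coe_finset]
    intro x hx y hy hxy
    have hxy : s(x, g x) = s(y, g y) := hxy
    exact key x hx y hy x (by simp) (hxy ▸ Sym2.mem_mk_left x (g x))

/-- If `B` is independent and has more than `m * q` vertices, where `m` bounds the size of every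
matching, then some `U` outside `B` encloses more than `q * U.card` vertices of `B`. -/
theorem exists_mul_card_lt_card_enclosedBy {V : Type*} [Fintype V] (H : SimpleGraph V)
    (B : Set V) (hind : ∀ b ∈ B, ∀ u, H.Adj b u → u ∉ B) (q m : ℕ)
    (hmax : ∀ M : Set (Sym2 V), IsMatchingSet H M → M.ncard ≤ m)
    (hB : m * q < B.ncard) :
    ∃ U : Finset V, (∀ u ∈ U, u ∉ B) ∧ q * U.card < (enclosedBy H B U).card := by
  classical
  by_contra! hU
  let t : B → Finset (V × Fin q) := fun b => H.neighborFinset b ×ˢ Finset.univ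
  have hall : ∀ s : Finset B, s.card ≤ (s.biUnion t).card := by
    intro s
    let N := s.biUnion fun b => H.neighborFinset b
    have hN : s.biUnion t = N ×ˢ Finset.univ := by
      ext ⟨a, i⟩
      simp [t, N]
    have hsub : s.map (Function.Embedding.subtype _) ⊆ enclosedBy H B N := by
      intro b hb
      obtain ⟨c, hc, rfl⟩ := Finset.mem_map.1 hb
      refine mem_enclosedBy.2 ⟨c.2, fun u hu => ?_⟩
      exact Finset.mem_biUnion.2 ⟨c, hc, (H.mem_neighborFinset _ _).2 hu⟩
    have hNB : ∀ u ∈ N, u ∉ B := by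
      intro u hu
      obtain ⟨b, -, hbu⟩ := Finset.mem_biUnion.1 hu
      exact hind b b.2 u ((H.mem_neighborFinset _ _).1 hbu)
    calc s.card = (s.map (Function.Embedding.subtype _)).card := (Finset.card_map _).symm
      _ ≤ (enclosedBy H B N).card := Finset.card_le_card hsub
      _ ≤ q * N.card := hU N hNB
      _ = (s.biUnion t).card := by rw [hN, Finset.card_product]; simp [mul_comm]
  obtain ⟨f, hf, hft⟩ := (Finset.all_card_le_biUnion_card_iff_exists_injective t).1 hall
  have hadj : ∀ b : B, H.Adj b (f b).1 := fun b => by simpa [t] using hft b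
  obtain ⟨i, -, hi⟩ : ∃ i ∈ (Finset.univ : Finset (Fin q)),
      m < ({b : B | (f b).2 = i} : Finset B).card := by
    refine Finset.exists_lt_card_fiber_of_mul_lt_card_of_maps_to
      (fun _ _ => Finset.mem_univ _) ?_
    rw [Finset.card_univ, Finset.card_univ, Fintype.card_fin, mul_comm, ← Nat.card_eq_fintype_card]
    exact hB
  let g : V → V := fun b => if hb : b ∈ B then (f ⟨b, hb⟩).1 else b
  have hg : ∀ b : B, g b = (f b).1 := fun b => by simp [g]
  let X := ({b : B | (f b).2 = i} : Finset B).map (Function.Embedding.subtype _)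
  have hX : ∀ x ∈ X, ∃ b : B, (f b).2 = i ∧ (b : V) = x := by
    intro x hx
    obtain ⟨b, hb, rfl⟩ := Finset.mem_map.1 hx
    exact ⟨b, (Finset.mem_filter.1 hb).2, rfl⟩
  obtain ⟨M, hM, hMX⟩ := exists_isMatchingSet_of_injOn H B X
    (by intro x hx; obtain ⟨b, -, rfl⟩ := hX x hx; exact b.2) g
    (by
      intro x hx y hy hxy
      obtain ⟨b, hb, rfl⟩ := hX x hx
      obtain ⟨c, hc, rfl⟩ := hX y hy
      rw [hg, hg] at hxy
      rw [hf (Prod.ext hxy (hb.trans hc.symm))])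
    (by intro x hx; obtain ⟨b, -, rfl⟩ := hX x hx; rw [hg]; exact hadj b)
    (by intro x hx; obtain ⟨b, -, rfl⟩ := hX x hx; rw [hg]; exact hind b b.2 _ (hadj b))
  have := hmax M hM
  rw [hMX, Finset.card_map] at this
  omega

/-- A set minimal among those enclosing more than `q * U.card` vertices is saturated by `q`-stars
into the set of vertices it encloses. -/
theorem saturatedByStars_enclosedBy {V : Type*} [Fintype V] (H : SimpleGraph V) (B : Set V)
    (q : ℕ) (U : Finset V) (hU : q * U.card < (enclosedBy H B U).card)
    (hmin : ∀ W ⊂ U, (enclosedBy H B W).card ≤ q * W.card) :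
    SaturatedByStars H q U (enclosedBy H B U) := by
  classical
  let t : U × Fin q → Finset V := fun p => H.neighborFinset p.1 ∩ enclosedBy H B U
  have hall : ∀ s : Finset (U × Fin q), s.card ≤ (s.biUnion t).card := by
    intro s
    rcases s.eq_empty_or_nonempty with rfl | ⟨p, hp⟩
    · simp
    let W : Finset V := s.image fun p => (p.1 : V)
    have hWU : W ⊆ U := by
      intro w hw
      obtain ⟨p, -, rfl⟩ := Finset.mem_image.1 hw
      exact p.1.2
    have hpW : (p.1 : V) ∈ W := Finset.mem_image_of_mem _ hp
    have hlt : U \ W ⊂ U :=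
      Finset.ssubset_iff_subset_ne.2 ⟨Finset.sdiff_subset, fun h => by
        have : (p.1 : V) ∈ U \ W := by rw [h]; exact p.1.2
        exact (Finset.mem_sdiff.1 this).2 hpW⟩
    have hsub : enclosedBy H B U ⊆ s.biUnion t ∪ enclosedBy H B (U \ W) := by
      intro b hb
      obtain ⟨hbB, hbU⟩ := mem_enclosedBy.1 hb
      by_cases h : ∃ w ∈ W, H.Adj b w
      · obtain ⟨w, hw, hbw⟩ := h
        obtain ⟨p, hp, rfl⟩ := Finset.mem_image.1 hw
        refine Finset.mem_union_left _ (Finset.mem_biUnion.2 ⟨p, hp, ?_⟩)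
        exact Finset.mem_inter.2 ⟨(H.mem_neighborFinset _ _).2 hbw.symm, hb⟩
      · push Not at h
        refine Finset.mem_union_right _ (mem_enclosedBy.2 ⟨hbB, fun u hu => ?_⟩)
        exact Finset.mem_sdiff.2 ⟨hbU u hu, fun hw => h u hw hu⟩
    have hsW : s.card ≤ q * W.card := by
      refine Finset.card_le_mul_card_image s q fun w _ => ?_
      calc _ ≤ (Finset.univ : Finset (Fin q)).card :=
            Finset.card_le_card_of_injOn Prod.snd (by simp) (by
              intro x hx y hy hxy
              simp only [Finset.coe_filter, Set.mem_ofPred_eq] at hx hy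
              exact Prod.ext (Subtype.ext (hx.2.trans hy.2.symm)) hxy)
        _ = q := by simp
    have h1 := (Finset.card_le_card hsub).trans (Finset.card_union_le _ _)
    have h2 := hmin _ hlt
    have h3 : q * (U \ W).card + q * W.card = q * U.card := by
      rw [← mul_add, Finset.card_sdiff_add_card_eq_card hWU]
    omega
  obtain ⟨f, hf, hft⟩ := (Finset.all_card_le_biUnion_card_iff_exists_injective t).1 hall
  refine ⟨fun v => {x | ∃ (hv : v ∈ U) (i : Fin q), f (⟨v, hv⟩, i) = x}, ?_, ?_⟩
  · intro v hv
    have hv' : v ∈ U := hv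
    refine ⟨?_, ?_⟩
    · rintro _ ⟨_, i, rfl⟩
      simpa [t] using hft (⟨v, hv'⟩, i)
    · have : {x | ∃ (hv : v ∈ U) (i : Fin q), f (⟨v, hv⟩, i) = x} =
          Set.range fun i : Fin q => f (⟨v, hv'⟩, i) := by
        ext x
        simp [hv']
      change Set.ncard {x | ∃ (hv : v ∈ U) (i : Fin q), f (⟨v, hv⟩, i) = x} = q
      rw [this, ← Set.image_univ, Set.ncard_image_of_injective, Set.ncard_univ, Nat.card_fin]
      intro i j hij
      simpa using hf hij
  · intro u _ v _ huv
    rw [Set.disjoint_left]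
    rintro _ ⟨hu, i, rfl⟩ ⟨hv, j, hj⟩
    have := hf hj
    simp only [Prod.mk.injEq, Subtype.mk.injEq] at this
    exact huv this.1.symm

/-- the `q`-expansion lemma: let `q` be a positive integer and
`m` the size of a maximum matching in a bipartite graph `H` with partite sets
`A` and `B`. If `|B| > m · q` and `B` has no isolated vertices, then there are
nonempty sets `S ⊆ A` and `T ⊆ B` such that `S` is saturated by `q`-stars into
`T` and `S = N_H(T)`. -/
theorem q_expansion_lemma
    {V : Type*} [Fintype V] (H : SimpleGraph V) (A B : Set V)
    (hcover : A ∪ B = Set.univ) (hdisj : Disjoint A B)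
    (hbip : ∀ u w : V, H.Adj u w → (u ∈ A ∧ w ∈ B) ∨ (u ∈ B ∧ w ∈ A))
    (q : ℕ) (hq : 0 < q) (m : ℕ)
    (M₀ : Set (Sym2 V)) (hM₀ : IsMatchingSet H M₀) (hM₀card : M₀.ncard = m)
    (hmax : ∀ M : Set (Sym2 V), IsMatchingSet H M → M.ncard ≤ m)
    (hB : B.ncard > m * q)
    (hnoiso : ∀ b ∈ B, ∃ u : V, H.Adj b u) :
    ∃ S T : Set V, S ⊆ A ∧ T ⊆ B ∧ S.Nonempty ∧ T.Nonempty ∧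
      SaturatedByStars H q S T ∧ S = {v | v ∉ T ∧ ∃ t ∈ T, H.Adj v t} := by
  have hnotA : ∀ v, v ∉ B → v ∈ A := fun v hv =>
    (hcover.symm ▸ Set.mem_univ v : v ∈ A ∪ B).resolve_right hv
  have hind : ∀ b ∈ B, ∀ u, H.Adj b u → u ∉ B := by
    intro b hb u hbu huB
    rcases hbip b u hbu with h | h
    · exact Set.disjoint_left.1 hdisj h.1 hb
    · exact Set.disjoint_left.1 hdisj h.2 huB
  obtain ⟨U, ⟨hUB, hU⟩, hmin⟩ := WellFounded.has_min (wellFounded_lt (α := Finset V))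
    {U | (∀ u ∈ U, u ∉ B) ∧ q * U.card < (enclosedBy H B U).card}
    (exists_mul_card_lt_card_enclosedBy H B hind q m hmax hB)
  have hsat := saturatedByStars_enclosedBy H B q U hU fun W hW => by
    by_contra! h
    exact hmin W ⟨fun u hu => hUB u (hW.1 hu), h⟩ hW
  obtain ⟨b, hb⟩ : (enclosedBy H B U).Nonempty := Finset.card_pos.1 (by omega)
  obtain ⟨u, hbu⟩ := hnoiso b (mem_enclosedBy.1 hb).1
  refine ⟨U, enclosedBy H B U, fun v hv => hnotA v (hUB v hv),
    fun t ht => (mem_enclosedBy.1 ht).1, ⟨u, (mem_enclosedBy.1 hb).2 u hbu⟩, ⟨b, hb⟩, hsat, ?_⟩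
  ext v
  constructor
  · intro hv
    refine ⟨fun h => hUB v hv (mem_enclosedBy.1 h).1, ?_⟩
    obtain ⟨f, hf, -⟩ := hsat
    obtain ⟨hfv, hcard⟩ := hf v hv
    obtain ⟨x, hx⟩ := Set.nonempty_of_ncard_ne_zero (s := f v) (by omega)
    exact ⟨x, (hfv hx).2, (hfv hx).1⟩
  · rintro ⟨-, t, ht, hvt⟩
    exact (mem_enclosedBy.1 ht).2 v hvt.symm
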